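/- arXiv:0711.1155 — 2 statements merged into one kernel-verified Lean document; each statement's English description precedes it below -/
import Mathlib

section
/- Let V be a complex vector space of dimension n > 1 with Hermitian inner product g and associated (1,1)-form η. Let α and β be real skew-symmetric (1,1)-forms on V. If α is nonnegative and β has the property that the g-trace of the restriction of its associated Hermitian form to every (n-1)-dimensional complex subspace is nonnegative, then the (n,n)-form γ = α ∧ β ∧ η^{n-2} is nonnegative, i.e., γ is a nonnegative multiple of η^n. -/
set_option synthInstance.maxHeartbeats 1000000
open scoped ComplexOrder
set_option maxHeartbeats 1000000

set_option maxHeartbeats 1000000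

open scoped BigOperators
noncomputable section

/-- The model `n`-dimensional complex vector space with its Hermitian inner product `g`
(unitary coordinates). -/
abbrev Em (n : ℕ) := EuclideanSpace ℂ (Fin n)

/-- The complexified dual: real-linear functionals with values in `ℂ`. -/
abbrev Wc (n : ℕ) := Em n →ₗ[ℝ] ℂ

/-- The exterior algebra of the complexified dual, where wedge products of forms live. -/
abbrev ExtAlg (n : ℕ) := ExteriorAlgebra ℂ (Wc n)

/-- The coordinate `(1,0)`-covector `ζ_j`. -/
noncomputable def zeta (n : ℕ) (j : Fin n) : Wc n :=
  ((EuclideanSpace.proj j : Em n →L[ℂ] ℂ).toLinearMap).restrictScalars ℝ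

/-- The conjugate coordinate `(0,1)`-covector `ζ̄_j`. -/
noncomputable def zetaBar (n : ℕ) (j : Fin n) : Wc n :=
  Complex.conjLIE.toLinearEquiv.toLinearMap ∘ₗ zeta n j

/-- The fundamental `(1,1)`-form `η = i Σ ζ_j ∧ ζ̄_j` of the Hermitian inner product. -/
noncomputable def eta (n : ℕ) : ExtAlg n :=
  Complex.I • ∑ j, ExteriorAlgebra.ι ℂ (zeta n j) * ExteriorAlgebra.ι ℂ (zetaBar n j)

/-- The real skew-symmetric `(1,1)`-form `i Σ A_{ij} ζ_i ∧ ζ̄_j` associated to a Hermitian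
matrix `A` (in unitary coordinates). -/
noncomputable def form11 (n : ℕ) (A : Matrix (Fin n) (Fin n) ℂ) : ExtAlg n :=
  Complex.I • ∑ i, ∑ j, A i j • (ExteriorAlgebra.ι ℂ (zeta n i) * ExteriorAlgebra.ι ℂ (zetaBar n j))

/-- The `(1,0)`-form `Σ a_j ζ_j` with coefficients `a`. -/
noncomputable def form10 (n : ℕ) (a : Fin n → ℂ) : ExtAlg n :=
  ∑ j, a j • ExteriorAlgebra.ι ℂ (zeta n j)

/-- The conjugate `(0,1)`-form `Σ ā_j ζ̄_j`. -/
noncomputable def form01 (n : ℕ) (a : Fin n → ℂ) : ExtAlg n :=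
  ∑ j, (starRingEnd ℂ (a j)) • ExteriorAlgebra.ι ℂ (zetaBar n j)

/-- The Hermitian form of the matrix `B` evaluated at `x`. -/
noncomputable def quadForm (n : ℕ) (B : Matrix (Fin n) (Fin n) ℂ) (x : Fin n → ℂ) : ℂ :=
  ∑ i, ∑ j, (starRingEnd ℂ) (x i) * B i j * x j

/-- The real covector `u_j = Re ζ_j` (valued in `ℂ` via the canonical embedding). -/
noncomputable def uu (n : ℕ) (j : Fin n) : Wc n :=
  (Complex.ofRealCLM.toLinearMap ∘ₗ Complex.reCLM.toLinearMap) ∘ₗ zeta n j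

/-- The real covector `v_j = Im ζ_j` (valued in `ℂ` via the canonical embedding). -/
noncomputable def vv (n : ℕ) (j : Fin n) : Wc n :=
  (Complex.ofRealCLM.toLinearMap ∘ₗ Complex.imCLM.toLinearMap) ∘ₗ zeta n j

/-- The real volume element `u_1 ∧ v_1 ∧ ⋯ ∧ u_n ∧ v_n`. -/
noncomputable def volForm (n : ℕ) : ExtAlg n :=
  (List.ofFn fun j : Fin n => ExteriorAlgebra.ι ℂ (uu n j) * ExteriorAlgebra.ι ℂ (vv n j)).prod
section SquareZero

variable {R ι : Type*} [CommRing R]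

lemma add_pow_succ_of_sq_zero {a : R} (ha : a * a = 0) (s : R) (m : ℕ) :
    (a + s) ^ (m + 1) = s ^ (m + 1) + (m + 1) * a * s ^ m := by
  induction m with
  | zero => simp [add_comm]
  | succ m ih =>
    rw [pow_succ, ih]
    push_cast
    linear_combination (m + 1) * s ^ m * ha

lemma Finset.sum_pow_eq_zero_of_sq_zero {w : ι → R} (hw : ∀ i, w i * w i = 0) (T : Finset ι)
    {m : ℕ} (hm : T.card < m) : (∑ i ∈ T, w i) ^ m = 0 := by
  classical
  induction T using Finset.induction_on generalizing m with
  | empty =>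
    rw [Finset.sum_empty, zero_pow (Nat.ne_zero_of_lt hm)]
  | insert a T ha ih =>
    rw [Finset.card_insert_of_notMem ha] at hm
    obtain ⟨k, rfl⟩ := Nat.exists_eq_succ_of_ne_zero (by lia : m ≠ 0)
    rw [Finset.sum_insert ha, add_pow_succ_of_sq_zero (hw a), ih (by lia), ih (by lia)]
    simp

lemma Finset.sum_pow_card_of_sq_zero {w : ι → R} (hw : ∀ i, w i * w i = 0) (T : Finset ι) :
    (∑ i ∈ T, w i) ^ T.card = (T.card.factorial : R) * ∏ i ∈ T, w i := by
  classical
  induction T using Finset.induction_on with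
  | empty => simp
  | insert a T ha ih =>
    rw [Finset.card_insert_of_notMem ha, Finset.sum_insert ha, add_pow_succ_of_sq_zero (hw a),
      Finset.sum_pow_eq_zero_of_sq_zero hw T (Nat.lt_succ_self _), ih, Finset.prod_insert ha,
      Nat.factorial_succ]
    push_cast
    ring

lemma mul_add_pow_of_mul_eq_zero {x s t : R} (h : x * s = 0) (m : ℕ) :
    x * (s + t) ^ m = x * t ^ m := by
  induction m with
  | zero => simp
  | succ m ih => linear_combination (s + t) * ih + t ^ m * h

end SquareZero

section Pairs

variable {R : Type*} [CommRing R] {n : ℕ} {P : Fin n → Fin n → R}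

/-- If `x` is annihilated by `w i` for `i ∈ U`, these indices may be dropped from `(∑ w) ^ m`. -/
lemma mul_sum_pow_eq_mul_sum_compl_pow {w : Fin n → R} {x : R} (U : Finset (Fin n))
    (hx : ∀ i ∈ U, x * w i = 0) (m : ℕ) :
    x * (∑ i, w i) ^ m = x * (∑ i ∈ Uᶜ, w i) ^ m := by
  rw [← Finset.sum_add_sum_compl U, mul_add_pow_of_mul_eq_zero]
  rw [Finset.mul_sum, Finset.sum_eq_zero hx]

lemma mul_mul_sum_diag_pow (hrow : ∀ i j l, P i j * P i l = 0) (hcol : ∀ i j k, P i j * P k j = 0)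
    (hswap : ∀ i j k l, P i j * P k l = -(P k j * P i l)) (i j k l : Fin n) :
    P i j * P k l * (∑ a, P a a) ^ (n - 2) =
      ((if i = j ∧ k = l then 1 else 0) - (if i = l ∧ k = j then 1 else 0)) *
        (((n - 2).factorial : R) * ∏ a, P a a) := by
  have hdiag : ∀ i k : Fin n, i ≠ k → P i i * P k k * (∑ a, P a a) ^ (n - 2) =
      ((n - 2).factorial : R) * ∏ a, P a a := by
    intro i k hik
    have hc : ({i, k} : Finset (Fin n))ᶜ.card = n - 2 := by
      rw [Finset.card_compl, Finset.card_pair hik, Fintype.card_fin]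
    rw [mul_sum_pow_eq_mul_sum_compl_pow {i, k}]
    · have := Finset.sum_pow_card_of_sq_zero (fun a => hrow a a a) ({i, k} : Finset (Fin n))ᶜ
      rw [hc] at this
      rw [this, ← Finset.prod_mul_prod_compl {i, k}, Finset.prod_pair hik]
      ring
    · intro a ha
      obtain rfl | rfl : a = i ∨ a = k := by simpa using ha
      · linear_combination P k k * hrow a a a
      · linear_combination P i i * hrow a a a
  by_cases hik : i = k
  · subst hik
    rw [hrow]
    have : (i = j ∧ i = l) ↔ (i = l ∧ i = j) := and_comm
    simp [this]
  by_cases hjl : j = l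
  · subst hjl
    rw [hcol]
    have : ¬ (i = j ∧ k = j) := fun h => hik (h.1.trans h.2.symm)
    simp [this]
  by_cases h1 : i = j ∧ k = l
  · obtain ⟨rfl, rfl⟩ := h1
    simp [hdiag i k hik, hik]
  by_cases h2 : i = l ∧ k = j
  · obtain ⟨rfl, rfl⟩ := h2
    rw [hswap, neg_mul, hdiag k i (Ne.symm hik)]
    simp [hik]
  simp only [h1, h2, if_false, sub_zero, zero_mul]
  have hcard : 3 ≤ ({i, j, k, l} : Finset (Fin n)).card := by
    rw [← not_lt]
    intro hlt
    have e1 : ({i, k} : Finset (Fin n)) = {i, j, k, l} := by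
      apply Finset.eq_of_subset_of_card_le
      · intro a; simp; tauto
      · rw [Finset.card_pair hik]; lia
    have e2 : ({j, l} : Finset (Fin n)) = {i, j, k, l} := by
      apply Finset.eq_of_subset_of_card_le
      · intro a; simp; tauto
      · rw [Finset.card_pair hjl]; lia
    have hi : i ∈ ({j, l} : Finset (Fin n)) := by rw [e2]; simp
    have hk : k ∈ ({j, l} : Finset (Fin n)) := by rw [e2]; simp
    simp only [Finset.mem_insert, Finset.mem_singleton] at hi hk
    grind
  have hle : ({i, j, k, l} : Finset (Fin n)).card ≤ n := by
    simpa using Finset.card_le_univ ({i, j, k, l} : Finset (Fin n))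
  rw [mul_sum_pow_eq_mul_sum_compl_pow {i, j, k, l},
    Finset.sum_pow_eq_zero_of_sq_zero (fun a => hrow a a a), mul_zero]
  · rw [Finset.card_compl, Fintype.card_fin]; lia
  · intro a ha
    simp only [Finset.mem_insert, Finset.mem_singleton] at ha
    rcases ha with rfl | rfl | rfl | rfl
    · linear_combination P k l * hrow a j a
    · linear_combination P k l * hcol i a a
    · linear_combination P i j * hrow a l a
    · linear_combination P i j * hcol k a a

lemma sum_smul_mul_sum_smul_mul_sum_diag_pow [Algebra ℂ R]
    (hrow : ∀ i j l, P i j * P i l = 0) (hcol : ∀ i j k, P i j * P k j = 0)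
    (hswap : ∀ i j k l, P i j * P k l = -(P k j * P i l)) (A B : Matrix (Fin n) (Fin n) ℂ) :
    (∑ i, ∑ j, A i j • P i j) * (∑ k, ∑ l, B k l • P k l) * (∑ a, P a a) ^ (n - 2) =
      (A.trace * B.trace - (A * B).trace) • (((n - 2).factorial : R) * ∏ a, P a a) := by
  have key (i j k l : Fin n) := mul_mul_sum_diag_pow hrow hcol hswap i j k l
  set Ω := ((n - 2).factorial : R) * ∏ a, P a a
  have : (∑ i, ∑ j, A i j • P i j) * (∑ k, ∑ l, B k l • P k l) * (∑ a, P a a) ^ (n - 2) =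
      ∑ k, ∑ l, ∑ i, ∑ j, (A i j * B k l *
        ((if i = j ∧ k = l then 1 else 0) - (if i = l ∧ k = j then 1 else 0))) • Ω := by
    simp only [Finset.sum_mul, Finset.mul_sum]
    refine Finset.sum_congr rfl fun k _ => Finset.sum_congr rfl fun l _ =>
      Finset.sum_congr rfl fun i _ => Finset.sum_congr rfl fun j _ => ?_
    rw [smul_mul_smul_comm, smul_mul_assoc, key, mul_smul (A i j * B k l)]
    congr 1
    split_ifs <;> simp
  rw [this]
  simp only [← Finset.sum_smul]
  congr 1
  simp only [mul_sub, Finset.sum_sub_distrib, ite_and, mul_ite, mul_one, mul_zero,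
    Finset.sum_ite_eq, Finset.mem_univ, if_true, Matrix.trace, Matrix.diag,
    Matrix.mul_apply, Finset.sum_mul_sum]
  simp only [Finset.sum_ite_eq, Finset.sum_ite_eq', Finset.sum_ite_irrel, Finset.sum_const_zero,
    Finset.mem_univ, if_true]
  exact congrArg₂ (· - ·) Finset.sum_comm Finset.sum_comm

end Pairs

section Exterior

variable {M : Type*} [AddCommGroup M] [Module ℂ M]

lemma ExteriorAlgebra.ι_mul_ι_swap (x y : M) : ι ℂ x * ι ℂ y = -(ι ℂ y * ι ℂ x) :=
  eq_neg_of_add_eq_zero_left (ExteriorAlgebra.ι_add_mul_swap x y)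

lemma ExteriorAlgebra.ι_pair_mul_ι_pair_swap (x y x' y' : M) :
    ι ℂ x * ι ℂ y * (ι ℂ x' * ι ℂ y') = -(ι ℂ x' * ι ℂ y * (ι ℂ x * ι ℂ y')) := by
  have h1 : ι ℂ x * ι ℂ y * (ι ℂ x' * ι ℂ y') = ι ℂ x * (ι ℂ y * ι ℂ x') * ι ℂ y' := by noncomm_ring
  have h2 : ι ℂ x' * ι ℂ y * (ι ℂ x * ι ℂ y') = ι ℂ x' * (ι ℂ y * ι ℂ x) * ι ℂ y' := by noncomm_ring
  rw [h1, h2, ι_mul_ι_swap y x', ι_mul_ι_swap y x, mul_neg, mul_neg, ← mul_assoc, ← mul_assoc,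
    ι_mul_ι_swap x x']
  noncomm_ring

lemma ExteriorAlgebra.ι_pair_mul_ι_pair_comm (x y x' y' : M) :
    ι ℂ x * ι ℂ y * (ι ℂ x' * ι ℂ y') = ι ℂ x' * ι ℂ y' * (ι ℂ x * ι ℂ y) := by
  rw [ι_pair_mul_ι_pair_swap]
  have h1 : ι ℂ x' * ι ℂ y * (ι ℂ x * ι ℂ y') = ι ℂ x' * (ι ℂ y * (ι ℂ x * ι ℂ y')) := by noncomm_ring
  have h2 : ι ℂ y * (ι ℂ x * ι ℂ y') = -(ι ℂ y' * (ι ℂ x * ι ℂ y)) := by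
    rw [ι_mul_ι_swap x y', ι_mul_ι_swap x y, mul_neg, mul_neg, ← mul_assoc, ← mul_assoc,
      ι_mul_ι_swap y y']
    noncomm_ring
  rw [h1, h2]
  noncomm_ring

lemma ExteriorAlgebra.ι_pair_mul_ι_pair_left (x y y' : M) :
    ι ℂ x * ι ℂ y * (ι ℂ x * ι ℂ y') = 0 := by
  have h : ι ℂ x * ι ℂ y * (ι ℂ x * ι ℂ y') = ι ℂ x * (ι ℂ y * ι ℂ x) * ι ℂ y' := by noncomm_ring
  rw [h, ι_mul_ι_swap y x, mul_neg, ← mul_assoc, ExteriorAlgebra.ι_sq_zero]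
  simp

lemma ExteriorAlgebra.ι_pair_mul_ι_pair_right (x x' y : M) :
    ι ℂ x * ι ℂ y * (ι ℂ x' * ι ℂ y) = 0 := by
  rw [ι_mul_ι_swap x' y, mul_neg, mul_assoc, ← mul_assoc (ι ℂ y), ExteriorAlgebra.ι_sq_zero]
  simp

/-- With `Ω = ∏ x_a ∧ y_a`, products of two `(1,1)`-elements and powers of `∑ x_a ∧ y_a` in
top degree are explicit multiples of `Ω`. -/
lemma ExteriorAlgebra.exists_top_pairing {n : ℕ} (x y : Fin n → M) :
    ∃ Ω : ExteriorAlgebra ℂ M, (∑ a, ι ℂ (x a) * ι ℂ (y a)) ^ n = (n.factorial : ℂ) • Ω ∧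
      ∀ A B : Matrix (Fin n) (Fin n) ℂ,
        (∑ i, ∑ j, A i j • (ι ℂ (x i) * ι ℂ (y j))) * (∑ k, ∑ l, B k l • (ι ℂ (x k) * ι ℂ (y l))) *
          (∑ a, ι ℂ (x a) * ι ℂ (y a)) ^ (n - 2) =
        ((A.trace * B.trace - (A * B).trace) * ((n - 2).factorial : ℂ)) • Ω := by
  let s : Set (ExteriorAlgebra ℂ M) :=
    Set.range fun p : Fin n × Fin n => ι ℂ (x p.1) * ι ℂ (y p.2)
  have hcomm : ∀ a ∈ s, ∀ b ∈ s, a * b = b * a := by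
    rintro _ ⟨p, rfl⟩ _ ⟨q, rfl⟩
    exact ι_pair_mul_ι_pair_comm _ _ _ _
  let : CommRing (Algebra.adjoin ℂ s) :=
    { (inferInstance : Ring (Algebra.adjoin ℂ s)) with
      mul_comm := (Algebra.isMulCommutative_adjoin ℂ hcomm).is_comm.comm }
  let P : Fin n → Fin n → Algebra.adjoin ℂ s := fun i j =>
    ⟨ι ℂ (x i) * ι ℂ (y j), Algebra.subset_adjoin ⟨(i, j), rfl⟩⟩
  have hrow (i j l) : P i j * P i l = 0 := Subtype.ext (ι_pair_mul_ι_pair_left _ _ _)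
  have hcol (i j k) : P i j * P k j = 0 := Subtype.ext (ι_pair_mul_ι_pair_right _ _ _)
  have hswap (i j k l) : P i j * P k l = -(P k j * P i l) :=
    Subtype.ext (ι_pair_mul_ι_pair_swap _ _ _ _)
  let φ := (Algebra.adjoin ℂ s).val
  have hφ (i j) : φ (P i j) = ι ℂ (x i) * ι ℂ (y j) := rfl
  refine ⟨φ (∏ a, P a a), ?_, fun A B => ?_⟩
  · have h := Finset.sum_pow_card_of_sq_zero (fun a => hrow a a a) Finset.univ
    rw [Finset.card_univ, Fintype.card_fin, ← nsmul_eq_mul] at h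
    have h' := congrArg φ h
    simp only [map_pow, map_sum, map_nsmul, hφ] at h'
    rw [h', Nat.cast_smul_eq_nsmul]
  · have h := sum_smul_mul_sum_smul_mul_sum_diag_pow hrow hcol hswap A B
    rw [← nsmul_eq_mul] at h
    have h' := congrArg φ h
    simp only [map_mul, map_pow, map_sum, map_smul, map_nsmul, hφ] at h'
    rw [h', mul_smul, Nat.cast_smul_eq_nsmul]

end Exterior

section Positivity

open Matrix

lemma Matrix.PosSemidef.trace_mul_nonneg {m : Type*} [Fintype m] {A B : Matrix m m ℂ}
    (hA : A.PosSemidef) (hB : B.PosSemidef) : 0 ≤ (A * B).trace := by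
  classical
  have h := (hA.hadamard hB.transpose).dotProduct_mulVec_nonneg 1
  simpa [dotProduct, mulVec, Matrix.trace, Matrix.mul_apply] using h

lemma quadForm_eq_dotProduct (n : ℕ) (B : Matrix (Fin n) (Fin n) ℂ) (x : Fin n → ℂ) :
    quadForm n B x = star x ⬝ᵥ (B *ᵥ x) := by
  simp [quadForm, dotProduct, mulVec, Finset.mul_sum, mul_assoc]

lemma sum_quadForm_orthonormalBasis (n : ℕ) (B : Matrix (Fin n) (Fin n) ℂ)
    (b : OrthonormalBasis (Fin n) ℂ (Em n)) : ∑ k, quadForm n B (fun i => b k i) = B.trace := by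
  have h := LinearMap.trace_eq_sum_inner (Matrix.toEuclideanLin B) b
  rw [Matrix.toEuclideanLin_eq_toLin_orthonormal, Matrix.trace_toLin_eq] at h
  rw [h]
  refine Finset.sum_congr rfl fun k _ => ?_
  rw [← Matrix.toEuclideanLin_eq_toLin_orthonormal, quadForm_eq_dotProduct,
    EuclideanSpace.inner_eq_star_dotProduct, Matrix.ofLp_toLpLin, dotProduct_comm]
  rfl

lemma posSemidef_trace_smul_one_sub (n : ℕ) (hn : 1 < n) (B : Matrix (Fin n) (Fin n) ℂ)
    (hBherm : B.IsHermitian)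
    (hB : ∀ e : Fin (n - 1) → Em n, Orthonormal ℂ e →
      0 ≤ (∑ k, quadForm n B (fun i => e k i)).re) :
    (B.trace • (1 : Matrix (Fin n) (Fin n) ℂ) - B).PosSemidef := by
  obtain ⟨m, rfl⟩ : ∃ m, n = m + 1 := ⟨n - 1, by lia⟩
  have htr : star B.trace = B.trace := by
    rw [← Matrix.trace_conjTranspose, hBherm.eq]
  have hherm : (B.trace • (1 : Matrix (Fin (m + 1)) (Fin (m + 1)) ℂ) - B).IsHermitian := by
    rw [Matrix.IsHermitian, conjTranspose_sub, conjTranspose_smul, conjTranspose_one, htr,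
      hBherm.eq]
  refine .of_dotProduct_mulVec_nonneg hherm fun x => ?_
  have him := hherm.im_star_dotProduct_mulVec_self x
  refine Complex.nonneg_iff.2 ⟨?_, him.symm⟩
  by_cases hx : x = 0
  · simp [hx]
  set x' : Em (m + 1) := WithLp.toLp 2 x with hx'
  have hx0 : x' ≠ 0 := by simpa [hx'] using hx
  set v : Em (m + 1) := ((‖x'‖ : ℂ)⁻¹) • x' with hv
  have hv1 : ‖v‖ = 1 := by simp [hv, norm_smul, hx0]
  have hxv : x = (‖x'‖ : ℂ) • v.ofLp := by
    have : (‖x'‖ : ℂ) ≠ 0 := by simpa using hx0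
    rw [hv, WithLp.ofLp_smul, smul_smul, mul_inv_cancel₀ this, one_smul]
  obtain ⟨b, hb⟩ := Orthonormal.exists_orthonormalBasis_extension_of_card_eq (𝕜 := ℂ)
    (E := Em (m + 1)) (ι := Fin (m + 1)) (by simp) (v := fun _ => v) (s := {0})
    (by
      rw [orthonormal_iff_ite]
      rintro ⟨i, rfl⟩ ⟨j, rfl⟩
      simp [inner_self_eq_norm_sq_to_K, hv1])
  have hb0 : b 0 = v := hb 0 rfl
  have hpos := hB (fun k => b k.succ) (b.orthonormal.comp _ (Fin.succ_injective m))
  have hsum := sum_quadForm_orthonormalBasis (m + 1) B b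
  rw [Fin.sum_univ_succ, hb0] at hsum
  have hvv : star v.ofLp ⬝ᵥ v.ofLp = 1 := by
    have := inner_self_eq_norm_sq_to_K (𝕜 := ℂ) v
    rw [EuclideanSpace.inner_eq_star_dotProduct, hv1, dotProduct_comm] at this
    simpa using this
  have hval : star x ⬝ᵥ ((B.trace • (1 : Matrix (Fin (m + 1)) (Fin (m + 1)) ℂ) - B) *ᵥ x) =
      ((‖x'‖ ^ 2 : ℝ) : ℂ) * ∑ k : Fin m, quadForm (m + 1) B (fun i => b k.succ i) := by
    have h2 : ∑ k : Fin m, quadForm (m + 1) B (fun i => b k.succ i) =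
        B.trace - star v.ofLp ⬝ᵥ (B *ᵥ v.ofLp) := by
      rw [← hsum, ← quadForm_eq_dotProduct]
      ring
    rw [h2, hxv]
    simp only [star_smul, smul_dotProduct, mulVec_smul, dotProduct_smul, sub_mulVec, smul_mulVec,
      one_mulVec, dotProduct_sub, hvv]
    simp
    ring
  rw [hval, Complex.re_ofReal_mul]
  exact mul_nonneg (by positivity) hpos

end Positivity

/-- Lemma 5.1(a): if `α ≥ 0` and `β ≥_(g,n-1) 0` (the `g`-trace of the Hermitian form of
`β` on every `(n-1)`-dimensional subspace is nonnegative), then `γ = α ∧ β ∧ η^(n-2)` is a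
nonnegative multiple of `η^n`. -/
theorem statement1 (n : ℕ) (hn : 1 < n) (A B : Matrix (Fin n) (Fin n) ℂ)
    (hA : A.PosSemidef) (hBherm : B.IsHermitian)
    (hB : ∀ e : Fin (n - 1) → Em n, Orthonormal ℂ e →
      0 ≤ (∑ k, quadForm n B (fun i => e k i)).re) :
    ∃ c : ℝ, 0 ≤ c ∧ form11 n A * form11 n B * eta n ^ (n - 2) = (c : ℂ) • eta n ^ n := by
  have hM := posSemidef_trace_smul_one_sub n hn B hBherm hB
  have hnn : 0 ≤ A.trace * B.trace - (A * B).trace := by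
    have h := hA.trace_mul_nonneg hM
    rwa [Matrix.mul_sub, Matrix.mul_smul, Matrix.mul_one, Matrix.trace_sub, Matrix.trace_smul,
      smul_eq_mul, mul_comm B.trace] at h
  obtain ⟨t, ht, hteq⟩ := RCLike.nonneg_iff_exists_ofReal.1 hnn
  obtain ⟨Ω, hΩ, hAB⟩ := ExteriorAlgebra.exists_top_pairing (zeta n) (zetaBar n)
  refine ⟨t * (n - 2).factorial / n.factorial, by positivity, ?_⟩
  have hI : Complex.I * Complex.I * Complex.I ^ (n - 2) = Complex.I ^ n := by
    rw [← pow_two, ← pow_add, Nat.add_sub_cancel' hn]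
  rw [form11, form11, eta, smul_pow, smul_pow, smul_mul_smul_comm, smul_mul_smul_comm, hAB, hΩ,
    hI, ← hteq, smul_smul, smul_smul, smul_smul]
  congr 1
  have : (n.factorial : ℂ) ≠ 0 := by exact_mod_cast n.factorial_ne_zero
  push_cast
  field_simp
  simp
end
end

section
/- Let V be a complex vector space of dimension n > 1 with Hermitian inner product g and associated (1,1)-form η. Let α be a real skew-symmetric (1,1)-form that is nonnegative, and let β be a real skew-symmetric (1,1)-form such that its associated Hermitian form B satisfies: for every choice of n-1 orthonormal vectors e_1,…,e_{n-1}, Σ B(e_j,e_j) > 0. If α ∧ β ∧ η^{n-2} = 0, then α = 0. -/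
set_option synthInstance.maxHeartbeats 1000000
open scoped ComplexOrder
set_option maxHeartbeats 1000000

set_option maxHeartbeats 1000000

open scoped BigOperators
noncomputable section

section NilpotentSums

variable {C ι : Type*} [CommRing C] [DecidableEq ι]

lemma add_pow_succ_of_sq_eq_zero {t : C} (ht : t * t = 0) (x : C) (c : ℕ) :
    (t + x) ^ (c + 1) = x ^ (c + 1) + (c + 1 : ℕ) * (t * x ^ c) := by
  induction c with
  | zero => simp [add_comm]
  | succ c ih =>
    rw [pow_succ, ih]
    push_cast
    linear_combination ((c : C) + 1) * x ^ c * ht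

lemma mul_add_pow_of_sq_eq_zero {t : C} (ht : t * t = 0) (x : C) (c : ℕ) :
    t * (t + x) ^ c = t * x ^ c := by
  cases c with
  | zero => simp
  | succ c =>
    rw [add_pow_succ_of_sq_eq_zero ht]
    linear_combination ((c + 1 : ℕ) : C) * x ^ c * ht

lemma sum_pow_card_of_sq_eq_zero {t : ι → C} (ht : ∀ i, t i * t i = 0) (s : Finset ι) :
    (∑ i ∈ s, t i) ^ s.card = (s.card.factorial : C) * ∏ i ∈ s, t i := by
  induction s using Finset.induction_on with
  | empty => simp
  | insert a s ha ih =>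
    have hzero : (∏ i ∈ s, t i) * ∑ i ∈ s, t i = 0 := by
      rw [Finset.mul_sum]
      refine Finset.sum_eq_zero fun i hi => ?_
      rw [← Finset.mul_prod_erase s t hi, mul_right_comm, ht, zero_mul]
    rw [Finset.sum_insert ha, Finset.prod_insert ha, Finset.card_insert_of_notMem ha,
      add_pow_succ_of_sq_eq_zero (ht a), pow_succ, ih, Nat.factorial_succ]
    push_cast
    linear_combination (s.card.factorial : C) * hzero

lemma sum_pow_of_card_eq_succ {t : ι → C} (ht : ∀ i, t i * t i = 0) (s : Finset ι) (c : ℕ)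
    (hc : s.card = c + 1) :
    (∑ i ∈ s, t i) ^ c = (c.factorial : C) * ∑ l ∈ s, ∏ i ∈ s.erase l, t i := by
  induction s using Finset.induction_on generalizing c with
  | empty => simp at hc
  | insert a s ha ih =>
    rw [Finset.card_insert_of_notMem ha, Nat.add_right_cancel_iff] at hc
    subst hc
    have hsum : ∑ l ∈ insert a s, ∏ i ∈ (insert a s).erase l, t i
        = ∏ i ∈ s, t i + t a * ∑ l ∈ s, ∏ i ∈ s.erase l, t i := by
      rw [Finset.sum_insert ha, Finset.erase_insert ha, Finset.mul_sum]
      congr 1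
      refine Finset.sum_congr rfl fun l hl => ?_
      rw [Finset.erase_insert_of_ne (ne_of_mem_of_not_mem hl ha).symm,
        Finset.prod_insert (fun h => ha (Finset.mem_of_mem_erase h))]
    rw [hsum, Finset.sum_insert ha]
    rcases hs : s.card with _ | c
    · simp [Finset.card_eq_zero.mp hs]
    · rw [add_pow_succ_of_sq_eq_zero (ht a), ih c hs, ← hs, sum_pow_card_of_sq_eq_zero ht, hs,
        Nat.factorial_succ]
      push_cast
      ring

/-- Mixed top-degree product of a diagonal form, an arbitrary form, and a power of the standard
form, expressed in terms of the products `w i j` of basis covectors. -/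
lemma diagonal_mul_sum_mul_pow {K : Type*} [CommRing K] [Algebra K C] [Fintype ι] {m : ℕ}
    (hcard : Fintype.card ι = m + 2) {w : ι → ι → C}
    (hleft : ∀ i j l, w i j * w i l = 0) (hright : ∀ i j l, w i j * w l j = 0)
    (a : ι → K) (b : ι → ι → K) :
    (∑ k, a k • w k k) * (∑ i, ∑ j, b i j • w i j) * (∑ k, w k k) ^ m
      = ((m.factorial : K) * ∑ k, a k * ∑ l ∈ Finset.univ.erase k, b l l) • ∏ i, w i i := by
  have ht : ∀ i, w i i * w i i = 0 := fun i => hleft i i i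
  have hb : ∀ l, (∑ i, ∑ j, b i j • w i j) * ∏ i ∈ Finset.univ.erase l, w i i
      = b l l • ∏ i, w i i := by
    intro l
    have hvanish : ∀ i j, i ≠ l ∨ j ≠ l → w i j * ∏ p ∈ Finset.univ.erase l, w p p = 0 := by
      rintro i j (h | h)
      · rw [← Finset.mul_prod_erase _ _ (Finset.mem_erase.mpr ⟨h, Finset.mem_univ i⟩),
          ← mul_assoc, hleft, zero_mul]
      · rw [← Finset.mul_prod_erase _ _ (Finset.mem_erase.mpr ⟨h, Finset.mem_univ j⟩),
          ← mul_assoc, hright, zero_mul]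
    simp only [Finset.sum_mul, smul_mul_assoc]
    rw [Finset.sum_eq_single l, Finset.sum_eq_single l, Finset.mul_prod_erase _ (fun i => w i i)
      (Finset.mem_univ l)]
    · intro j _ hj
      rw [hvanish _ _ (Or.inr hj), smul_zero]
    · simp
    · intro i _ hi
      exact Finset.sum_eq_zero fun j _ => by rw [hvanish _ _ (Or.inl hi), smul_zero]
    · simp
  have hk : ∀ k, w k k * (∑ j, w j j) ^ m
      = (m.factorial : C) * ∑ l ∈ Finset.univ.erase k, ∏ i ∈ Finset.univ.erase l, w i i := by
    intro k
    rw [← Finset.add_sum_erase _ (fun j => w j j) (Finset.mem_univ k),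
      mul_add_pow_of_sq_eq_zero (ht k), sum_pow_of_card_eq_succ ht _ m
        (by rw [Finset.card_erase_of_mem (Finset.mem_univ k), Finset.card_univ, hcard]; rfl),
      mul_left_comm, Finset.mul_sum]
    congr 1
    refine Finset.sum_congr rfl fun l hl => ?_
    rw [Finset.erase_right_comm]
    exact Finset.mul_prod_erase _ (fun i => w i i)
      (Finset.mem_erase.mpr ⟨(Finset.ne_of_mem_erase hl).symm, Finset.mem_univ k⟩)
  rw [mul_right_comm, Finset.sum_mul, Finset.sum_mul, Finset.mul_sum, Finset.sum_smul]
  refine Finset.sum_congr rfl fun k _ => ?_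
  rw [smul_mul_assoc, hk, smul_mul_assoc, mul_assoc, Finset.sum_mul]
  simp_rw [mul_comm _ (∑ i, ∑ j, b i j • w i j), hb]
  rw [← Finset.sum_smul, ← nsmul_eq_mul, ← Nat.cast_smul_eq_nsmul K, smul_smul, smul_smul]
  congr 1
  ring

end NilpotentSums

section ExteriorAlgebra

open ExteriorAlgebra

variable {R M : Type*} [CommRing R] [AddCommGroup M] [Module R M]

lemma ExteriorAlgebra.ι_mul_ι_comm (a b : M) : ι R a * ι R b = -(ι R b * ι R a) :=
  eq_neg_of_add_eq_zero_left (ι_add_mul_swap a b)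

lemma ExteriorAlgebra.ι_mul_ι_mem_center (a b : M) :
    ι R a * ι R b ∈ Subalgebra.center R (ExteriorAlgebra R M) := by
  rw [Subalgebra.mem_center_iff]
  intro x
  induction x using ExteriorAlgebra.induction with
  | algebraMap r => exact Algebra.commutes r _
  | ι c =>
    rw [← mul_assoc, ι_mul_ι_comm c a, neg_mul, mul_assoc, ι_mul_ι_comm c b, mul_neg, neg_neg,
      mul_assoc]
  | mul x y hx hy => rw [mul_assoc, hy, ← mul_assoc, hx, mul_assoc]
  | add x y hx hy => rw [add_mul, mul_add, hx, hy]

/-- The product of two degree-one elements, as an element of the centre. -/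
def ExteriorAlgebra.wedgePair (a b : M) : Subalgebra.center R (ExteriorAlgebra R M) :=
  ⟨ι R a * ι R b, ι_mul_ι_mem_center a b⟩

lemma ExteriorAlgebra.wedgePair_mul_wedgePair_left (a b c : M) :
    wedgePair (R := R) a b * wedgePair a c = 0 := by
  apply Subtype.ext
  change ι R a * ι R b * (ι R a * ι R c) = 0
  rw [ι_mul_ι_comm a b, neg_mul, mul_assoc, ← mul_assoc (ι R a) (ι R a), ι_sq_zero, zero_mul,
    mul_zero, neg_zero]

lemma ExteriorAlgebra.wedgePair_mul_wedgePair_right (a b c : M) :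
    wedgePair (R := R) a b * wedgePair c b = 0 := by
  apply Subtype.ext
  change ι R a * ι R b * (ι R c * ι R b) = 0
  rw [ι_mul_ι_comm c b, mul_neg, mul_assoc, ← mul_assoc (ι R b) (ι R b), ι_sq_zero, zero_mul,
    mul_zero, neg_zero]

open CliffordAlgebra in
lemma ExteriorAlgebra.contractLeft_ι_mul (d : Module.Dual R M) (a : M) (x : ExteriorAlgebra R M) :
    contractLeft (Q := (0 : QuadraticForm R M)) d (ι R a * x)
      = d a • x - ι R a * contractLeft (Q := (0 : QuadraticForm R M)) d x :=
  CliffordAlgebra.contractLeft_ι_mul d a x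

open CliffordAlgebra in
lemma ExteriorAlgebra.contractLeft_prod_wedgePair {κ : Type*} [DecidableEq κ]
    {a b : κ → M} {d : Module.Dual R M} (s : Finset κ)
    (ha : ∀ i ∈ s, d (a i) = 0) (hb : ∀ i ∈ s, d (b i) = 0) :
    contractLeft (Q := (0 : QuadraticForm R M)) d
      ((∏ i ∈ s, wedgePair (R := R) (a i) (b i) : Subalgebra.center R (ExteriorAlgebra R M)) :
        ExteriorAlgebra R M) = 0 := by
  induction s using Finset.induction_on with
  | empty => exact contractLeft_one _ d
  | insert i s hi ih =>
    rw [Finset.prod_insert hi]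
    change contractLeft (Q := (0 : QuadraticForm R M)) d (ι R (a i) * ι R (b i) * _) = 0
    rw [mul_assoc, ExteriorAlgebra.contractLeft_ι_mul, ExteriorAlgebra.contractLeft_ι_mul,
      ih (fun j hj => ha j (Finset.mem_insert_of_mem hj))
        (fun j hj => hb j (Finset.mem_insert_of_mem hj)),
      ha i (Finset.mem_insert_self i s), hb i (Finset.mem_insert_self i s)]
    simp

open CliffordAlgebra in
lemma ExteriorAlgebra.prod_wedgePair_ne_zero [Nontrivial R] {κ : Type*} [DecidableEq κ]
    {a b : κ → M} {d e : κ → Module.Dual R M}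
    (hda : ∀ i j, d i (a j) = if i = j then 1 else 0) (hdb : ∀ i j, d i (b j) = 0)
    (hea : ∀ i j, e i (a j) = 0) (heb : ∀ i j, e i (b j) = if i = j then 1 else 0)
    (s : Finset κ) : ∏ i ∈ s, wedgePair (R := R) (a i) (b i) ≠ 0 := by
  induction s using Finset.induction_on with
  | empty =>
    intro h
    exact one_ne_zero (α := ExteriorAlgebra R M) (congrArg Subtype.val h)
  | insert i s hi ih =>
    intro h
    apply ih
    apply Subtype.ext
    rw [Finset.prod_insert hi] at h
    have h' : ι R (a i) * (ι R (b i) *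
        ((∏ i ∈ s, wedgePair (R := R) (a i) (b i) : Subalgebra.center R (ExteriorAlgebra R M)) :
          ExteriorAlgebra R M)) = 0 := by
      rw [← mul_assoc]
      exact congrArg Subtype.val h
    have hne : ∀ j ∈ s, i ≠ j := fun j hj hij => hi (hij ▸ hj)
    have hd := contractLeft_prod_wedgePair (R := R) (a := a) (b := b) (d := d i) s
      (fun j hj => by rw [hda, if_neg (hne j hj)]) (fun j _ => hdb i j)
    have he := contractLeft_prod_wedgePair (R := R) (a := a) (b := b) (d := e i) s
      (fun j _ => hea i j) (fun j hj => by rw [heb, if_neg (hne j hj)])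
    have h₁ := congrArg (contractLeft (Q := (0 : QuadraticForm R M)) (d i)) h'
    rw [ExteriorAlgebra.contractLeft_ι_mul, ExteriorAlgebra.contractLeft_ι_mul, hd, hda, hdb,
      if_pos rfl, one_smul, zero_smul, mul_zero, sub_zero, mul_zero, sub_zero, map_zero] at h₁
    have h₂ := congrArg (contractLeft (Q := (0 : QuadraticForm R M)) (e i)) h₁
    rwa [ExteriorAlgebra.contractLeft_ι_mul, he, heb, if_pos rfl, one_smul, mul_zero, sub_zero,
      map_zero] at h₂

end ExteriorAlgebra

section UnitaryCoframe

open ExteriorAlgebra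

variable {n : ℕ}

/-- The `(1,0)`-covector `Σ U_{ik} ζ_i` attached to the `k`-th column of `U`. -/
def coframe (U : Matrix (Fin n) (Fin n) ℂ) (k : Fin n) : Wc n := ∑ i, U i k • zeta n i

/-- The `(0,1)`-covector conjugate to `coframe U k`. -/
def coframeBar (U : Matrix (Fin n) (Fin n) ℂ) (k : Fin n) : Wc n :=
  ∑ i, star (U i k) • zetaBar n i

lemma sum_comm_pairs {κ E : Type*} [Fintype κ] [AddCommMonoid E] (F : κ → κ → κ → κ → E) :
    ∑ i, ∑ j, ∑ k, ∑ l, F i j k l = ∑ k, ∑ l, ∑ i, ∑ j, F i j k l := by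
  calc ∑ i, ∑ j, ∑ k, ∑ l, F i j k l
      = ∑ i, ∑ k, ∑ j, ∑ l, F i j k l := Finset.sum_congr rfl fun i _ => Finset.sum_comm
    _ = ∑ k, ∑ i, ∑ j, ∑ l, F i j k l := Finset.sum_comm
    _ = ∑ k, ∑ i, ∑ l, ∑ j, F i j k l := Finset.sum_congr rfl fun k _ =>
      Finset.sum_congr rfl fun i _ => Finset.sum_comm
    _ = ∑ k, ∑ l, ∑ i, ∑ j, F i j k l := Finset.sum_congr rfl fun k _ => Finset.sum_comm

lemma form11_conj (U M : Matrix (Fin n) (Fin n) ℂ) :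
    form11 n (U * M * star U)
      = Complex.I • ∑ k, ∑ l, M k l • (ι ℂ (coframe U k) * ι ℂ (coframeBar U l)) := by
  have hentry : ∀ i j, (U * M * star U) i j = ∑ k, ∑ l, U i k * M k l * star (U j l) := by
    intro i j
    simp only [Matrix.mul_apply, Matrix.star_apply, Finset.sum_mul]
    exact Finset.sum_comm
  have hpair : ∀ k l, M k l • (ι ℂ (coframe U k) * ι ℂ (coframeBar U l))
      = ∑ i, ∑ j, (U i k * M k l * star (U j l)) • (ι ℂ (zeta n i) * ι ℂ (zetaBar n j)) := by
    intro k l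
    simp only [coframe, coframeBar, map_sum, map_smul, Finset.sum_mul_sum, smul_mul_smul_comm,
      Finset.smul_sum, smul_smul]
    refine Finset.sum_congr rfl fun i _ => Finset.sum_congr rfl fun j _ => ?_
    congr 1
    ring
  simp only [form11, hentry, hpair, Finset.sum_smul]
  exact congrArg (Complex.I • ·) (sum_comm_pairs fun i j k l =>
    (U i k * M k l * star (U j l)) • (ι ℂ (zeta n i) * ι ℂ (zetaBar n j)))

/-- The functional extracting the `(1,0)`-part of a covector at `v`. -/
def evalHol (v : Em n) : Module.Dual ℂ (Wc n) where
  toFun f := (f v - Complex.I * f (Complex.I • v)) / 2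
  map_add' f g := by simp only [LinearMap.add_apply]; ring
  map_smul' c f := by simp only [LinearMap.smul_apply, smul_eq_mul, RingHom.id_apply]; ring

/-- The functional extracting the `(0,1)`-part of a covector at `v`. -/
def evalAntihol (v : Em n) : Module.Dual ℂ (Wc n) where
  toFun f := (f v + Complex.I * f (Complex.I • v)) / 2
  map_add' f g := by simp only [LinearMap.add_apply]; ring
  map_smul' c f := by simp only [LinearMap.smul_apply, smul_eq_mul, RingHom.id_apply]; ring

lemma evalHol_zeta (v : Em n) (j : Fin n) : evalHol v (zeta n j) = v j := by
  change (v j - Complex.I * (Complex.I * v j)) / 2 = v j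
  linear_combination (-(v j) / 2) * Complex.I_mul_I

lemma evalHol_zetaBar (v : Em n) (j : Fin n) : evalHol v (zetaBar n j) = 0 := by
  change (star (v j) - Complex.I * star (Complex.I * v j)) / 2 = 0
  simp only [star_mul', Complex.star_def, Complex.conj_I]
  linear_combination (starRingEnd ℂ (v j) / 2) * Complex.I_mul_I

lemma evalAntihol_zeta (v : Em n) (j : Fin n) : evalAntihol v (zeta n j) = 0 := by
  change (v j + Complex.I * (Complex.I * v j)) / 2 = 0
  linear_combination (v j / 2) * Complex.I_mul_I

lemma evalAntihol_zetaBar (v : Em n) (j : Fin n) :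
    evalAntihol v (zetaBar n j) = star (v j) := by
  change (star (v j) + Complex.I * star (Complex.I * v j)) / 2 = star (v j)
  simp only [star_mul', Complex.star_def, Complex.conj_I]
  linear_combination (-starRingEnd ℂ (v j) / 2) * Complex.I_mul_I

lemma prod_wedgePair_coframe_ne_zero {U : Matrix (Fin n) (Fin n) ℂ} (hU : star U * U = 1) :
    ∏ k, wedgePair (R := ℂ) (coframe U k) (coframeBar U k) ≠ 0 := by
  have horth : ∀ i j, ∑ k, star (U k i) * U k j = if i = j then 1 else 0 := fun i j => by
    rw [← Matrix.one_apply, ← hU, Matrix.mul_apply]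
    rfl
  refine prod_wedgePair_ne_zero
    (d := fun i => evalHol (WithLp.toLp 2 fun k => star (U k i)))
    (e := fun i => evalAntihol (WithLp.toLp 2 fun k => star (U k i)))
    (fun i j => ?_) (fun i j => ?_) (fun i j => ?_) (fun i j => ?_) Finset.univ
  · simp only [coframe, map_sum, map_smul, evalHol_zeta, smul_eq_mul]
    rw [← horth i j]
    exact Finset.sum_congr rfl fun k _ => mul_comm _ _
  · simp [coframeBar, evalHol_zetaBar]
  · simp [coframe, evalAntihol_zeta]
  · simp only [coframeBar, map_sum, map_smul, evalAntihol_zetaBar, smul_eq_mul, star_star]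
    rw [horth j i]
    exact if_congr eq_comm rfl rfl

lemma form11_one : form11 n 1 = eta n := by
  simp [form11, eta, Matrix.one_apply]

lemma star_mul_mul_apply_self (U B : Matrix (Fin n) (Fin n) ℂ) (l : Fin n) :
    (star U * B * U) l l = quadForm n B fun i => U i l := by
  simp only [quadForm, Matrix.mul_apply, Matrix.star_apply, Finset.sum_mul]
  exact Finset.sum_comm

/-- The top-degree coefficient of `α ∧ β ∧ η^(n-2)` in a unitary coframe diagonalizing `α`. -/
lemma sum_eigenvalue_mul_eq_zero {m : ℕ} {U : Matrix (Fin (m + 2)) (Fin (m + 2)) ℂ}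
    (hU : star U * U = 1) (a : Fin (m + 2) → ℂ) (B : Matrix (Fin (m + 2)) (Fin (m + 2)) ℂ)
    (h : form11 (m + 2) (U * Matrix.diagonal a * star U) * form11 (m + 2) B
      * eta (m + 2) ^ m = 0) :
    ∑ k, a k * ∑ l ∈ Finset.univ.erase k, quadForm (m + 2) B (fun i => U i l) = 0 := by
  have hU' : U * star U = 1 := mul_eq_one_comm.mp hU
  have hB : U * (star U * B * U) * star U = B := by
    rw [← mul_assoc, ← mul_assoc, hU', one_mul, mul_assoc, hU', mul_one]
  have hη : form11 (m + 2) (U * 1 * star U) = eta (m + 2) := by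
    rw [mul_one, hU', form11_one]
  set w : Fin (m + 2) → Fin (m + 2) → Subalgebra.center ℂ (ExtAlg (m + 2)) :=
    fun i j => wedgePair (coframe U i) (coframeBar U j)
  have hform : ∀ M, form11 (m + 2) (U * M * star U)
      = ((Complex.I • ∑ k, ∑ l, M k l • w k l : Subalgebra.center ℂ (ExtAlg (m + 2))) :
        ExtAlg (m + 2)) := by
    intro M
    rw [form11_conj]
    push_cast
    rfl
  rw [← hη, ← hB, hform, hform, hform] at h
  norm_cast at h
  have hdiag : ∑ k, ∑ l, Matrix.diagonal a k l • w k l = ∑ k, a k • w k k := by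
    refine Finset.sum_congr rfl fun k _ => ?_
    rw [Finset.sum_eq_single k (fun l _ hl => by
      rw [Matrix.diagonal_apply_ne' _ hl, zero_smul]) (by simp), Matrix.diagonal_apply_eq]
  have hone : ∑ k, ∑ l, (1 : Matrix (Fin (m + 2)) (Fin (m + 2)) ℂ) k l • w k l
      = ∑ k, w k k := by
    simp [Matrix.one_apply]
  rw [hdiag, hone, smul_pow, smul_mul_smul_comm, smul_mul_smul_comm] at h
  have hprod := diagonal_mul_sum_mul_pow (w := w) (Fintype.card_fin _)
    (fun _ _ _ => wedgePair_mul_wedgePair_left _ _ _)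
    (fun _ _ _ => wedgePair_mul_wedgePair_right _ _ _) a (fun i j => (star U * B * U) i j)
  replace h := (congrArg _ hprod).symm.trans h
  have hI : Complex.I * Complex.I * Complex.I ^ m ≠ 0 := by simp
  have h0 := ((smul_eq_zero.mp ((smul_eq_zero.mp h).resolve_left hI)).resolve_right
    (prod_wedgePair_coframe_ne_zero hU))
  simpa only [star_mul_mul_apply_self] using
    (mul_eq_zero.mp h0).resolve_left (Nat.cast_ne_zero.mpr m.factorial_ne_zero)

end UnitaryCoframe

/-- Lemma 5.1(c): if `α ≥ 0`, `β >_(g,n-1) 0` (the `g`-trace of the Hermitian form of `β`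
on every `(n-1)`-dimensional subspace is positive), and `α ∧ β ∧ η^(n-2) = 0`, then `α = 0`. -/
theorem statement2 (n : ℕ) (hn : 1 < n) (A B : Matrix (Fin n) (Fin n) ℂ)
    (hA : A.PosSemidef) (hBherm : B.IsHermitian)
    (hB : ∀ e : Fin (n - 1) → Em n, Orthonormal ℂ e →
      0 < (∑ k, quadForm n B (fun i => e k i)).re)
    (h : form11 n A * form11 n B * eta n ^ (n - 2) = 0) :
    form11 n A = 0 := by
  obtain ⟨m, rfl⟩ : ∃ m, n = m + 2 := ⟨n - 2, by omega⟩
  set b := hA.isHermitian.eigenvectorBasis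
  set lam := hA.isHermitian.eigenvalues
  set U : Matrix (Fin (m + 2)) (Fin (m + 2)) ℂ := hA.isHermitian.eigenvectorUnitary.1
  have hU : star U * U = 1 := Unitary.coe_star_mul_self _
  have hspec : A = U * Matrix.diagonal (fun k => (lam k : ℂ)) * star U := by
    have := hA.isHermitian.spectral_theorem
    rwa [Unitary.conjStarAlgAut_apply] at this
  have hsum := sum_eigenvalue_mul_eq_zero hU (fun k => (lam k : ℂ)) B (hspec ▸ h)
  have hpos : ∀ k, 0 < (∑ l ∈ Finset.univ.erase k, quadForm (m + 2) B fun i => U i l).re := by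
    intro k
    have hk := hB (fun l => b (k.succAbove l))
      (b.orthonormal.comp _ Fin.succAbove_right_injective)
    have himage : (Finset.univ : Finset (Fin (m + 2))).erase k
        = Finset.univ.map k.succAboveEmb := by
      ext l
      simp [Fin.exists_succAbove_eq_iff]
    rw [himage, Finset.sum_map]
    exact hk
  have hnonneg : ∀ k, 0 ≤ lam k := hA.eigenvalues_nonneg
  have hre := congrArg Complex.re hsum
  simp only [Complex.re_sum, Complex.re_ofReal_mul, Complex.zero_re] at hre hpos
  rw [Finset.sum_eq_zero_iff_of_nonneg
    fun k _ => mul_nonneg (hnonneg k) (hpos k).le] at hre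
  have hlam : ∀ k, lam k = 0 := fun k =>
    (mul_eq_zero.mp (hre k (Finset.mem_univ k))).resolve_right (hpos k).ne'
  have hzero : A = 0 := by
    rw [hspec]
    simp [hlam]
  simp [hzero, form11]
end
end
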